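/- arXiv:1011.2997 — 2 statements merged into one kernel-verified Lean document; each statement's English description precedes it below -/
import Mathlib

section
/- (1) For each a ∈ I₁ \ F with n := dim_K coker(a_{K[x]}) (finite by the Compact–Fredholm Alternative), there exists f ∈ F such that the operator (∂^n + f)∘a on K[x] is surjective, and its kernel equals the kernel of a_{K[x]}. (2) For each a ∈ I₁ \ F with n := dim_K ker(a_{K[x]}), there exists g ∈ F such that the operator a∘(∫^n + g) on K[x] is injective, and its image equals the image of a_{K[x]}. (3) For each a ∈ I₁ \ F with m := dim_K ker(a_{K[x]}) and n := dim_K coker(a_{K[x]}), there exist f, g ∈ F such that the operator (∂^n + f)∘a∘(∫^m + g) on K[x] is bijective. -/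
open Polynomial

noncomputable section
set_option synthInstance.maxHeartbeats 1000000
set_option maxHeartbeats 1000000
set_option linter.unusedSectionVars false

variable (K : Type*) [Field K] [CharZero K]

/-- The derivative operator `∂ = d/dx` on `K[x]`. -/
def derOp : Module.End K (Polynomial K) := Polynomial.derivative

/-- The multiplication-by-`x` operator on `K[x]`. -/
def xOp : Module.End K (Polynomial K) := LinearMap.mulLeft K Polynomial.X

/-- The integration operator `∫`, determined by `∫ xⁿ = xⁿ⁺¹/(n+1)`. -/
def intOp : Module.End K (Polynomial K) :=
  (Polynomial.basisMonomials K).constr K fun n => ((n : K) + 1)⁻¹ • X ^ (n + 1)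

/-- The algebra `I₁` of polynomial integro-differential operators: the subalgebra of
`End_K(K[x])` generated by `x`, `∂` and `∫`. -/
def I1 : Subalgebra K (Module.End K (Polynomial K)) :=
  Algebra.adjoin K {xOp K, derOp K, intOp K}

/-- `e_{ij} := ∫^i ∂^j − ∫^{i+1} ∂^{j+1}`. -/
def eOp (i j : ℕ) : Module.End K (Polynomial K) :=
  intOp K ^ i * derOp K ^ j - intOp K ^ (i + 1) * derOp K ^ (j + 1)

/-- `F`, the `K`-linear span of the `e_{ij}`; it is the (two-sided) ideal of compact
operators of `I₁`. -/
def Fset : Submodule K (Module.End K (Polynomial K)) :=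
  Submodule.span K {f | ∃ i j, f = eOp K i j}

lemma xOp_mem : xOp K ∈ I1 K := Algebra.subset_adjoin (by simp)
lemma derOp_mem : derOp K ∈ I1 K := Algebra.subset_adjoin (by simp)
lemma intOp_mem : intOp K ∈ I1 K := Algebra.subset_adjoin (by simp)

lemma eOp_mem (i j : ℕ) : eOp K i j ∈ I1 K :=
  sub_mem (mul_mem (pow_mem (intOp_mem K) i) (pow_mem (derOp_mem K) j))
    (mul_mem (pow_mem (intOp_mem K) (i + 1)) (pow_mem (derOp_mem K) (j + 1)))

/-- `e_{ij}` as an element of the ring `I₁`. -/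
def eI (i j : ℕ) : I1 K := ⟨eOp K i j, eOp_mem K i j⟩

/-- `∂` as an element of the ring `I₁`. -/
def derI : I1 K := ⟨derOp K, derOp_mem K⟩

/-- `∫` as an element of the ring `I₁`. -/
def intI : I1 K := ⟨intOp K, intOp_mem K⟩

/-- `H := ∂ ∘ x` (first multiply by `x`, then differentiate). -/
def hOp : Module.End K (Polynomial K) := derOp K * xOp K

/-- `K[H]`, the unital subalgebra of `I₁` generated by `H`. -/
def KH : Subalgebra K (Module.End K (Polynomial K)) := Algebra.adjoin K {hOp K}

/-- The action of `a ∈ I₁` on a left `I₁`-module `M`, as a `K`-linear map `a_M : M → M`. -/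
def actMap (a : I1 K) (M : Type*) [AddCommGroup M] [Module (I1 K) M] [Module K M]
    [SMulCommClass K (I1 K) M] : M →ₗ[K] M where
  toFun m := a • m
  map_add' := smul_add a
  map_smul' k m := (smul_comm k a m).symm

/-- Right multiplication `b ↦ b * a` in a ring `R`, as a homomorphism of left `R`-modules. -/
def rmulMap (R : Type*) [Ring R] (a : R) : R →ₗ[R] R where
  toFun b := b * a
  map_add' b c := add_mul b c a
  map_smul' c b := by simp [smul_eq_mul, mul_assoc]

/-- Left multiplication `b ↦ a * b` in a ring `R`, as a homomorphism of right `R`-modules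
(i.e. of left `Rᵐᵒᵖ`-modules). -/
def lmulMap (R : Type*) [Ring R] (a : R) : R →ₗ[Rᵐᵒᵖ] R where
  toFun b := a * b
  map_add' b c := mul_add a b c
  map_smul' c b := by simp [MulOpposite.smul_eq_mul_unop, mul_assoc]

/-- The centralizer `Cen_{I₁}(a) = {b ∈ I₁ : ab = ba}` of `a` in `I₁`, as a subalgebra of
`End_K(K[x])`. -/
def Cen (a : Module.End K (Polynomial K)) : Subalgebra K (Module.End K (Polynomial K)) :=
  I1 K ⊓ Subalgebra.centralizer K {a}

/-- `Cen_F(a) = {f ∈ F : af = fa}`, a `K`-subspace of `End_K(K[x])`. -/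
def CenF (a : Module.End K (Polynomial K)) : Submodule K (Module.End K (Polynomial K)) :=
  Fset K ⊓ Subalgebra.toSubmodule (Subalgebra.centralizer K {a})


/-- The divided power `xⁿ/n!`. -/
def divPow (n : ℕ) : Polynomial K := monomial n (n.factorial : K)⁻¹

lemma factorial_cast_ne_zero (n : ℕ) : (n.factorial : K) ≠ 0 :=
  Nat.cast_ne_zero.mpr n.factorial_ne_zero

lemma X_pow_eq_smul_divPow (n : ℕ) : (X ^ n : Polynomial K) = (n.factorial : K) • divPow K n := by
  rw [divPow, smul_monomial, smul_eq_mul, mul_inv_cancel₀ (factorial_cast_ne_zero K n),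
    monomial_one_right_eq_X_pow]

lemma divPow_eq_smul_X_pow (n : ℕ) : divPow K n = (n.factorial : K)⁻¹ • (X ^ n : Polynomial K) := by
  rw [X_pow_eq_smul_divPow, smul_smul, inv_mul_cancel₀ (factorial_cast_ne_zero K n), one_smul]

variable {K}

lemma end_ext_divPow {f g : Module.End K (Polynomial K)}
    (h : ∀ n, f (divPow K n) = g (divPow K n)) : f = g := by
  refine (basisMonomials K).ext fun n => ?_
  simp only [coe_basisMonomials, monomial_one_right_eq_X_pow, X_pow_eq_smul_divPow, map_smul, h]

variable (K)

lemma intOp_X_pow (n : ℕ) : intOp K (X ^ n) = ((n : K) + 1)⁻¹ • X ^ (n + 1) := by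
  have := (basisMonomials K).constr_basis K
    (fun n => ((n : K) + 1)⁻¹ • (X : Polynomial K) ^ (n + 1)) n
  simp only [coe_basisMonomials, monomial_one_right_eq_X_pow] at this
  rw [intOp, this]

@[simp] lemma intOp_divPow (n : ℕ) : intOp K (divPow K n) = divPow K (n + 1) := by
  rw [divPow_eq_smul_X_pow, map_smul, intOp_X_pow, divPow_eq_smul_X_pow, smul_smul]
  congr 1
  rw [Nat.factorial_succ]
  push_cast
  rw [mul_inv, mul_comm]

@[simp] lemma derOp_divPow_succ (n : ℕ) : derOp K (divPow K (n + 1)) = divPow K n := by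
  have h : ((n : K) + 1) ≠ 0 := by exact_mod_cast n.succ_ne_zero
  have h' := factorial_cast_ne_zero K n
  rw [derOp, divPow, derivative_monomial, divPow, Nat.factorial_succ]
  push_cast
  congr 1
  field_simp

@[simp] lemma derOp_divPow_zero : derOp K (divPow K 0) = 0 := by
  simp [derOp, divPow]

lemma derOp_mul_intOp : derOp K * intOp K = 1 :=
  end_ext_divPow fun n => by simp

lemma derOp_pow_mul_intOp_pow (n : ℕ) : derOp K ^ n * intOp K ^ n = 1 := by
  induction n with
  | zero => simp
  | succ n ih =>
    rw [pow_succ, pow_succ', mul_assoc, ← mul_assoc (derOp K) (intOp K), derOp_mul_intOp, one_mul, ih]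

@[simp] lemma derOp_pow_intOp_pow (n : ℕ) (p : Polynomial K) :
    (derOp K ^ n) ((intOp K ^ n) p) = p := by
  rw [← Module.End.mul_apply, derOp_pow_mul_intOp_pow, Module.End.one_apply]

@[simp] lemma intOp_pow_divPow (k n : ℕ) : (intOp K ^ k) (divPow K n) = divPow K (n + k) := by
  induction k generalizing n with
  | zero => simp
  | succ k ih => rw [pow_succ, Module.End.mul_apply, intOp_divPow, ih, add_right_comm, add_assoc]

lemma derOp_pow_divPow_add (k n : ℕ) : (derOp K ^ k) (divPow K (n + k)) = divPow K n := by
  rw [← intOp_pow_divPow, derOp_pow_intOp_pow]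

lemma derOp_pow_divPow_of_lt {k n : ℕ} (h : n < k) : (derOp K ^ k) (divPow K n) = 0 := by
  obtain ⟨j, rfl⟩ := Nat.exists_eq_add_of_lt h
  have := derOp_pow_divPow_add K n 0
  rw [zero_add] at this
  rw [add_assoc, add_comm n, pow_add, Module.End.mul_apply, this, pow_succ, Module.End.mul_apply,
    derOp_divPow_zero, map_zero]

lemma divPow_coeff (n m : ℕ) : (divPow K n).coeff m = if n = m then (n.factorial : K)⁻¹ else 0 :=
  coeff_monomial

lemma divPow_mem_degreeLT {m n : ℕ} (h : n < m) : divPow K n ∈ degreeLT K m :=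
  mem_degreeLT.mpr ((degree_monomial_le _ _).trans_lt (by exact_mod_cast h))

variable {K}

lemma degreeLT_le_of_divPow_mem {n : ℕ} {S : Submodule K (Polynomial K)}
    (h : ∀ i < n, divPow K i ∈ S) : degreeLT K n ≤ S := by
  classical
  rw [degreeLT_eq_span_X_pow, Submodule.span_le]
  intro p hp
  simp only [Finset.coe_image, Set.mem_image, Finset.mem_coe, Finset.mem_range] at hp
  obtain ⟨i, hi, rfl⟩ := hp
  rw [X_pow_eq_smul_divPow]
  exact S.smul_mem _ (h i hi)

lemma mem_degreeLT_of_succ {n : ℕ} {p : Polynomial K} (hp : p ∈ degreeLT K (n + 1))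
    (h : p.coeff n = 0) : p ∈ degreeLT K n := by
  rw [mem_degreeLT, degree_lt_iff_coeff_zero] at *
  intro m hm
  rcases hm.eq_or_lt with rfl | hm
  · exact h
  · exact hp m hm

lemma exists_mem_degreeLT (p : Polynomial K) : ∃ n, p ∈ degreeLT K n :=
  ⟨p.natDegree + 1, mem_degreeLT.mpr (by
    exact (degree_le_natDegree).trans_lt (by exact_mod_cast Nat.lt_succ_self _))⟩

lemma sub_intOp_pow_derOp_pow_mem_degreeLT (n : ℕ) (p : Polynomial K) :
    p - (intOp K ^ n) ((derOp K ^ n) p) ∈ degreeLT K n := by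
  obtain ⟨m, hm⟩ := exists_mem_degreeLT p
  refine degreeLT_le_of_divPow_mem (n := m)
    (S := (degreeLT K n).comap (1 - intOp K ^ n * derOp K ^ n)) (fun i _ => ?_) hm
  rw [Submodule.mem_comap, LinearMap.sub_apply, Module.End.one_apply, Module.End.mul_apply]
  rcases lt_or_ge i n with h | h
  · rw [derOp_pow_divPow_of_lt K h, map_zero, sub_zero]
    exact divPow_mem_degreeLT K h
  · obtain ⟨j, rfl⟩ := Nat.exists_eq_add_of_le' h
    rw [derOp_pow_divPow_add, intOp_pow_divPow, sub_self]
    exact Submodule.zero_mem _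

lemma mem_degreeLT_iff_derOp_pow {n : ℕ} {p : Polynomial K} :
    p ∈ degreeLT K n ↔ (derOp K ^ n) p = 0 := by
  constructor
  · intro h
    exact degreeLT_le_of_divPow_mem (S := LinearMap.ker (derOp K ^ n))
      (fun i hi => derOp_pow_divPow_of_lt K hi) h
  · intro h
    simpa [h] using sub_intOp_pow_derOp_pow_mem_degreeLT n p

lemma eOp_divPow (i j n : ℕ) : eOp K i j (divPow K n) = if n = j then divPow K i else 0 := by
  rw [eOp, LinearMap.sub_apply, Module.End.mul_apply, Module.End.mul_apply]
  rcases lt_trichotomy n j with h | rfl | h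
  · rw [derOp_pow_divPow_of_lt K h, derOp_pow_divPow_of_lt K (h.trans j.lt_succ_self), if_neg h.ne]
    simp
  · have := derOp_pow_divPow_add K n 0
    rw [zero_add] at this
    rw [this, derOp_pow_divPow_of_lt K n.lt_succ_self, if_pos rfl]
    simp
  · obtain ⟨k, rfl⟩ := Nat.exists_eq_add_of_lt h
    rw [if_neg h.ne', show j + k + 1 = (k + 1) + j by ring, derOp_pow_divPow_add,
      show k + 1 + j = k + (j + 1) by ring, derOp_pow_divPow_add, intOp_pow_divPow,
      intOp_pow_divPow, show k + 1 + i = k + (i + 1) by ring, sub_self]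

lemma smulRight_lcoeff_mem_Fset (j : ℕ) (p : Polynomial K) :
    (lcoeff K j).smulRight p ∈ Fset K := by
  obtain ⟨m, hm⟩ := exists_mem_degreeLT p
  refine degreeLT_le_of_divPow_mem (n := m)
    (S := (Fset K).comap (LinearMap.smulRightₗ (lcoeff K j))) (fun i _ => ?_) hm
  rw [Submodule.mem_comap]
  have : LinearMap.smulRightₗ (lcoeff K j) (divPow K i) = (j.factorial : K)⁻¹ • eOp K i j := by
    refine end_ext_divPow fun n => ?_
    change (divPow K n).coeff j • divPow K i = _
    rw [LinearMap.smul_apply, eOp_divPow, divPow_coeff]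
    split_ifs with h
    · rw [h]
    · simp
  rw [this]
  exact (Fset K).smul_mem _ (Submodule.subset_span ⟨i, j, rfl⟩)

lemma mem_Fset_of_mul_intOp_pow {f : Module.End K (Polynomial K)} {N : ℕ}
    (h : f * intOp K ^ N = 0) : f ∈ Fset K := by
  have hf : f = ∑ j ∈ Finset.range N, (lcoeff K j).smulRight (f (X ^ j)) := by
    refine end_ext_divPow fun n => ?_
    rw [LinearMap.sum_apply]
    simp only [LinearMap.smulRight_apply, lcoeff_apply, divPow_coeff, ite_smul, zero_smul]
    rw [Finset.sum_ite_eq]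
    split_ifs with hn
    · rw [← map_smul, ← divPow_eq_smul_X_pow]
    · rw [Finset.mem_range, not_lt] at hn
      obtain ⟨k, rfl⟩ := Nat.exists_eq_add_of_le' hn
      rw [← intOp_pow_divPow, ← Module.End.mul_apply, h, LinearMap.zero_apply]
  rw [hf]
  exact sum_mem fun j _ => smulRight_lcoeff_mem_Fset j _

/-! ### Operators raising degrees by a constant -/

section Shift

variable {c : Module.End K (Polynomial K)} {s : ℕ}

lemma injective_of_shift (hdeg : ∀ m, c (divPow K m) ∈ degreeLT K (m + s + 1))
    (hcoeff : ∀ m, (c (divPow K m)).coeff (m + s) ≠ 0) : Function.Injective c := by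
  have key : ∀ n, ∀ p ∈ degreeLT K n, c p = 0 → p = 0 := by
    intro n
    induction n with
    | zero =>
      intro p hp _
      rwa [mem_degreeLT_iff_derOp_pow, pow_zero, Module.End.one_apply] at hp
    | succ n ih =>
      intro p hp hc
      set q := p - (p.coeff n * n.factorial) • divPow K n with hq
      have hqn : q ∈ degreeLT K n := by
        refine mem_degreeLT_of_succ (sub_mem hp (Submodule.smul_mem _ _
          (divPow_mem_degreeLT K n.lt_succ_self))) ?_
        simp [hq, divPow_coeff, factorial_cast_ne_zero K n]
      have hcq : c q ∈ degreeLT K (n + s) :=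
        degreeLT_le_of_divPow_mem (S := (degreeLT K (n + s)).comap c)
          (fun i hi => degreeLT_mono (by omega) (hdeg i)) hqn
      have h0 : (c q).coeff (n + s) = 0 := by
        rw [mem_degreeLT, degree_lt_iff_coeff_zero] at hcq
        exact hcq _ le_rfl
      rw [hq, map_sub, hc, map_smul, zero_sub, coeff_neg, coeff_smul, neg_eq_zero, smul_eq_mul,
        mul_eq_zero, or_iff_left (hcoeff n), mul_eq_zero,
        or_iff_left (factorial_cast_ne_zero K n)] at h0
      exact ih p (mem_degreeLT_of_succ hp h0) hc
  rw [injective_iff_map_eq_zero]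
  intro p
  obtain ⟨n, hn⟩ := exists_mem_degreeLT p
  exact key n p hn

lemma range_sup_degreeLT_of_shift (hdeg : ∀ m, c (divPow K m) ∈ degreeLT K (m + s + 1))
    (hcoeff : ∀ m, (c (divPow K m)).coeff (m + s) ≠ 0) :
    LinearMap.range c ⊔ degreeLT K s = ⊤ := by
  have key : ∀ n, degreeLT K (n + s) ≤ LinearMap.range c ⊔ degreeLT K s := by
    intro n
    induction n with
    | zero => rw [zero_add]; exact le_sup_right
    | succ n ih =>
      intro p hp
      rw [add_right_comm] at hp
      set r := (p.coeff (n + s) / (c (divPow K n)).coeff (n + s)) • c (divPow K n) with hr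
      have hpr : p - r ∈ degreeLT K (n + s) := by
        refine mem_degreeLT_of_succ (sub_mem hp (Submodule.smul_mem _ _ (hdeg n))) ?_
        rw [coeff_sub, hr, coeff_smul, smul_eq_mul, div_mul_cancel₀ _ (hcoeff n), sub_self]
      rw [← sub_add_cancel p r]
      exact add_mem (ih hpr) (Submodule.smul_mem _ _
        (Submodule.mem_sup_left (LinearMap.mem_range_self c _)))
  rw [eq_top_iff]
  intro p _
  obtain ⟨n, hn⟩ := exists_mem_degreeLT p
  exact key n (degreeLT_mono (Nat.le_add_right n s) hn)

end Shift

instance finiteDimensional_degreeLT (n : ℕ) : FiniteDimensional K (degreeLT K n) :=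
  (degreeLTEquiv K n).symm.finiteDimensional

lemma finrank_degreeLT (n : ℕ) : Module.finrank K (degreeLT K n) = n := by
  rw [(degreeLTEquiv K n).finrank_eq, Module.finrank_fin_fun]

lemma finiteDimensional_quotient_of_sup_eq_top {V : Type*} [AddCommGroup V] [Module K V]
    {S T : Submodule K V} [FiniteDimensional K T] (h : S ⊔ T = ⊤) :
    FiniteDimensional K (V ⧸ S) := by
  refine Module.Finite.of_surjective (S.mkQ.comp T.subtype) ?_
  rw [← LinearMap.range_eq_top, LinearMap.range_comp, Submodule.range_subtype,
    Submodule.map_mkQ_eq_top, h]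

/-! ### The asymptotic form of an integro-differential operator -/

/-- The operator acting on `xⁿ` as multiplication by the scalar `q(n)`. -/
def diagOp (q : Polynomial K) : Module.End K (Polynomial K) :=
  (basisMonomials K).constr K fun n => q.eval (n : K) • X ^ n

@[simp] lemma diagOp_divPow (q : Polynomial K) (n : ℕ) :
    diagOp q (divPow K n) = q.eval (n : K) • divPow K n := by
  have := (basisMonomials K).constr_basis K (fun n => q.eval (n : K) • (X : Polynomial K) ^ n) n
  simp only [coe_basisMonomials, monomial_one_right_eq_X_pow] at this
  rw [divPow_eq_smul_X_pow, map_smul, diagOp, this, smul_comm]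

lemma diagOp_one : diagOp (1 : Polynomial K) = 1 := end_ext_divPow fun n => by simp

lemma diagOp_mul (q r : Polynomial K) : diagOp q * diagOp r = diagOp (q * r) :=
  end_ext_divPow fun n => by simp [smul_smul, mul_comm]

lemma diagOp_mul_intOp_pow (q : Polynomial K) (k : ℕ) :
    diagOp q * intOp K ^ k = intOp K ^ k * diagOp (q.comp (X + C (k : K))) :=
  end_ext_divPow fun n => by simp

variable (K)

/-- The span of the operators `∫^k ∘ q(x d/dx)`. -/
def raisingOps : Submodule K (Module.End K (Polynomial K)) :=
  Submodule.span K {t | ∃ k q, t = intOp K ^ k * diagOp q}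

variable {K}

lemma intOp_pow_mul_diagOp_mem (k : ℕ) (q : Polynomial K) :
    intOp K ^ k * diagOp q ∈ raisingOps K :=
  Submodule.subset_span ⟨k, q, rfl⟩

lemma intOp_pow_mem_raisingOps (k : ℕ) : intOp K ^ k ∈ raisingOps K := by
  simpa [diagOp_one] using intOp_pow_mul_diagOp_mem (K := K) k 1

lemma one_mem_raisingOps : (1 : Module.End K (Polynomial K)) ∈ raisingOps K := by
  simpa using intOp_pow_mem_raisingOps (K := K) 0

lemma mul_mem_raisingOps {s t : Module.End K (Polynomial K)} (hs : s ∈ raisingOps K)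
    (ht : t ∈ raisingOps K) : s * t ∈ raisingOps K := by
  induction hs, ht using Submodule.span_induction₂ with
  | mem_mem x y hx hy =>
    obtain ⟨k, q, rfl⟩ := hx
    obtain ⟨l, r, rfl⟩ := hy
    rw [mul_assoc, ← mul_assoc (diagOp q), diagOp_mul_intOp_pow, mul_assoc, diagOp_mul,
      ← mul_assoc, ← pow_add]
    exact intOp_pow_mul_diagOp_mem _ _
  | zero_left y hy => simp
  | zero_right x hx => simp
  | add_left x y z hx hy hz h₁ h₂ => rw [add_mul]; exact add_mem h₁ h₂
  | add_right x y z hx hy hz h₁ h₂ => rw [mul_add]; exact add_mem h₁ h₂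
  | smul_left r x y hx hy h => rw [smul_mul_assoc]; exact Submodule.smul_mem _ _ h
  | smul_right r x y hx hy h => rw [mul_smul_comm]; exact Submodule.smul_mem _ _ h

lemma exists_mul_intOp_pow_eq {t : Module.End K (Polynomial K)} (ht : t ∈ raisingOps K) (d : ℕ) :
    ∃ u ∈ raisingOps K, t * intOp K ^ d = intOp K ^ d * u := by
  induction ht using Submodule.span_induction with
  | mem x hx =>
    obtain ⟨k, q, rfl⟩ := hx
    refine ⟨_, intOp_pow_mul_diagOp_mem k (q.comp (X + C (d : K))), ?_⟩
    rw [mul_assoc, diagOp_mul_intOp_pow, ← mul_assoc, ← mul_assoc, ← pow_add, ← pow_add,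
      add_comm]
  | zero => exact ⟨0, zero_mem _, by simp⟩
  | add x y _ _ hx hy =>
    obtain ⟨u, hu, hxu⟩ := hx
    obtain ⟨v, hv, hyv⟩ := hy
    exact ⟨u + v, add_mem hu hv, by rw [add_mul, mul_add, hxu, hyv]⟩
  | smul r x _ hx =>
    obtain ⟨u, hu, hxu⟩ := hx
    exact ⟨r • u, Submodule.smul_mem _ _ hu, by rw [smul_mul_assoc, mul_smul_comm, hxu]⟩

lemma exists_mul_intOp_pow_mem_raisingOps {a : Module.End K (Polynomial K)} (ha : a ∈ I1 K) :
    ∃ d, a * intOp K ^ d ∈ raisingOps K := by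
  induction ha using Algebra.adjoin_induction with
  | mem x hx =>
    rcases hx with rfl | rfl | rfl
    · refine ⟨0, ?_⟩
      have : xOp K = intOp K ^ 1 * diagOp (X + 1) := by
        refine end_ext_divPow fun n => ?_
        have h : ((n : K) + 1) ≠ 0 := by exact_mod_cast n.succ_ne_zero
        have h' := factorial_cast_ne_zero K n
        simp only [xOp, LinearMap.mulLeft_apply, Module.End.mul_apply, diagOp_divPow, map_smul,
          intOp_pow_divPow, eval_add, eval_X, eval_one]
        rw [divPow, X_mul_monomial, divPow, smul_monomial, Nat.factorial_succ]
        push_cast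
        congr 1
        rw [smul_eq_mul]
        field_simp
      rw [this, pow_zero, mul_one]
      exact intOp_pow_mul_diagOp_mem _ _
    · exact ⟨1, by rw [pow_one, derOp_mul_intOp]; exact one_mem_raisingOps⟩
    · exact ⟨0, by simpa using intOp_pow_mem_raisingOps (K := K) 1⟩
  | algebraMap r =>
    refine ⟨0, ?_⟩
    rw [pow_zero, mul_one, Algebra.algebraMap_eq_smul_one]
    exact Submodule.smul_mem _ _ one_mem_raisingOps
  | add x y _ _ hx hy =>
    obtain ⟨d, hd⟩ := hx
    obtain ⟨e, he⟩ := hy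
    refine ⟨d + e, ?_⟩
    rw [add_mul]
    refine add_mem ?_ ?_
    · rw [pow_add, ← mul_assoc]
      exact mul_mem_raisingOps hd (intOp_pow_mem_raisingOps e)
    · rw [add_comm, pow_add, ← mul_assoc]
      exact mul_mem_raisingOps he (intOp_pow_mem_raisingOps d)
  | mul x y _ _ hx hy =>
    obtain ⟨d, hd⟩ := hx
    obtain ⟨e, he⟩ := hy
    obtain ⟨u, hu, h⟩ := exists_mul_intOp_pow_eq he d
    refine ⟨e + d, ?_⟩
    rw [pow_add, mul_assoc, ← mul_assoc y, h, ← mul_assoc]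
    exact mul_mem_raisingOps hd hu

lemma exists_sum_of_mem_raisingOps {t : Module.End K (Polynomial K)} (ht : t ∈ raisingOps K) :
    ∃ p : ℕ →₀ Polynomial K, ∀ m : ℕ,
      t (divPow K m) = p.sum fun k q => q.eval (m : K) • divPow K (m + k) := by
  induction ht using Submodule.span_induction with
  | mem x hx =>
    obtain ⟨k, q, rfl⟩ := hx
    exact ⟨Finsupp.single k q, fun m => by simp⟩
  | zero => exact ⟨0, by simp⟩
  | add x y _ _ hx hy =>
    obtain ⟨p, hp⟩ := hx
    obtain ⟨q, hq⟩ := hy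
    refine ⟨p + q, fun m => ?_⟩
    rw [Finsupp.sum_add_index' (by simp) (by simp [add_smul]), LinearMap.add_apply, hp, hq]
  | smul r x _ hx =>
    obtain ⟨p, hp⟩ := hx
    refine ⟨r • p, fun m => ?_⟩
    rw [Finsupp.sum_smul_index' (by simp), LinearMap.smul_apply, hp, Finsupp.smul_sum]
    simp [mul_smul]

lemma exists_eval_natCast_ne_zero {q : Polynomial K} (hq : q ≠ 0) :
    ∃ N : ℕ, ∀ m : ℕ, q.eval ((m + N : ℕ) : K) ≠ 0 := by
  have hfin : {n : ℕ | q.IsRoot (n : K)}.Finite :=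
    (finite_setOfPred_isRoot hq).preimage Nat.cast_injective.injOn
  obtain ⟨B, hB⟩ := hfin.bddAbove
  refine ⟨B + 1, fun m hm => ?_⟩
  have : m + (B + 1) ≤ B := hB hm
  omega

lemma exists_shift_of_notMem_Fset {a : Module.End K (Polynomial K)} (haI : a ∈ I1 K)
    (haF : a ∉ Fset K) :
    ∃ e s, (∀ m, (a * intOp K ^ e) (divPow K m) ∈ degreeLT K (m + s + 1)) ∧
      ∀ m, ((a * intOp K ^ e) (divPow K m)).coeff (m + s) ≠ 0 := by
  obtain ⟨d, hd⟩ := exists_mul_intOp_pow_mem_raisingOps haI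
  obtain ⟨p, hp⟩ := exists_sum_of_mem_raisingOps hd
  have hp0 : p ≠ 0 := by
    rintro rfl
    exact haF (mem_Fset_of_mul_intOp_pow (end_ext_divPow fun n => by
      rw [hp, Finsupp.sum_zero_index, LinearMap.zero_apply]))
  have hs := Finsupp.support_nonempty_iff.mpr hp0
  set k := p.support.max' hs with hk
  have hkmem : k ∈ p.support := p.support.max'_mem hs
  obtain ⟨N, hN⟩ := exists_eval_natCast_ne_zero (Finsupp.mem_support_iff.mp hkmem)
  have happ : ∀ m, (a * intOp K ^ (d + N)) (divPow K m) =
      p.sum fun j q => q.eval ((m + N : ℕ) : K) • divPow K (m + N + j) := fun m => by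
    rw [pow_add, ← mul_assoc, Module.End.mul_apply, intOp_pow_divPow, hp]
  refine ⟨d + N, N + k, fun m => ?_, fun m => ?_⟩
  · rw [happ]
    refine sum_mem fun j hj => Submodule.smul_mem _ _ (divPow_mem_degreeLT K ?_)
    have := p.support.le_max' j hj
    omega
  · rw [happ, Finsupp.sum, finsetSum_coeff, Finset.sum_eq_single k]
    · rw [coeff_smul, divPow_coeff, if_pos (by omega), smul_eq_mul]
      exact mul_ne_zero (hN m) (inv_ne_zero (factorial_cast_ne_zero K _))
    · intro j _ hj
      rw [coeff_smul, divPow_coeff, if_neg (by omega), smul_zero]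
    · intro h
      exact absurd hkmem h

lemma finiteDimensional_coker {a : Module.End K (Polynomial K)} (haI : a ∈ I1 K)
    (haF : a ∉ Fset K) : FiniteDimensional K (Polynomial K ⧸ LinearMap.range a) := by
  obtain ⟨e, s, hdeg, hcoeff⟩ := exists_shift_of_notMem_Fset haI haF
  refine finiteDimensional_quotient_of_sup_eq_top (T := degreeLT K s) ?_
  rw [eq_top_iff, ← range_sup_degreeLT_of_shift hdeg hcoeff]
  exact sup_le_sup_right (LinearMap.range_comp_le_range _ _) _

lemma finiteDimensional_ker {a : Module.End K (Polynomial K)} (haI : a ∈ I1 K)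
    (haF : a ∉ Fset K) : FiniteDimensional K (LinearMap.ker a) := by
  obtain ⟨e, s, hdeg, hcoeff⟩ := exists_shift_of_notMem_Fset haI haF
  have hinj := injective_of_shift hdeg hcoeff
  have : LinearMap.range (intOp K ^ e) ⊔ degreeLT K e = ⊤ := by
    rw [eq_top_iff]
    intro p _
    rw [← add_sub_cancel ((intOp K ^ e) ((derOp K ^ e) p)) p]
    exact Submodule.add_mem_sup (LinearMap.mem_range_self _ _)
      (sub_intOp_pow_derOp_pow_mem_degreeLT e p)
  have := finiteDimensional_quotient_of_sup_eq_top this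
  refine Module.Finite.of_injective
    ((LinearMap.range (intOp K ^ e)).mkQ.comp (LinearMap.ker a).subtype) ?_
  rw [injective_iff_map_eq_zero]
  rintro ⟨p, hp⟩ h
  rw [LinearMap.comp_apply, Submodule.subtype_apply, Submodule.mkQ_apply,
    Submodule.Quotient.mk_eq_zero] at h
  obtain ⟨q, rfl⟩ := h
  have hq : q = 0 := hinj (by rw [map_zero]; exact hp)
  simp [hq]

/-! ### Prescribing the kernel or a complement of the image -/

lemma exists_le_degreeLT (W : Submodule K (Polynomial K)) [FiniteDimensional K W] :
    ∃ N, W ≤ degreeLT K N := by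
  have hW : W.FG := Module.Finite.iff_fg.mp inferInstance
  obtain ⟨s, rfl⟩ := hW
  refine ⟨s.sup natDegree + 1, Submodule.span_le.mpr fun p hp => ?_⟩
  refine mem_degreeLT.mpr (degree_le_natDegree.trans_lt ?_)
  exact_mod_cast Nat.lt_succ_of_le (Finset.le_sup (f := natDegree) hp)

variable (K) in
/-- The truncation of polynomials to degrees less than `n`. -/
def truncOp (n : ℕ) : Polynomial K →ₗ[K] degreeLT K n :=
  (1 - intOp K ^ n * derOp K ^ n : Module.End K (Polynomial K)).codRestrict (degreeLT K n)
    (sub_intOp_pow_derOp_pow_mem_degreeLT n)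

lemma coe_truncOp (n : ℕ) (p : Polynomial K) :
    (truncOp K n p : Polynomial K) = p - (intOp K ^ n) ((derOp K ^ n) p) := rfl

lemma truncOp_coe_add (n : ℕ) (r : degreeLT K n) (p : Polynomial K) :
    truncOp K n (r + (intOp K ^ n) p) = r := by
  ext1
  rw [coe_truncOp, map_add, mem_degreeLT_iff_derOp_pow.mp r.2, zero_add, derOp_pow_intOp_pow,
    add_sub_cancel_right]

lemma truncOp_intOp_pow (n : ℕ) (p : Polynomial K) : truncOp K n ((intOp K ^ n) p) = 0 := by
  simpa using truncOp_coe_add n 0 p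

lemma exists_surjective_ker_eq (W : Submodule K (Polynomial K)) [FiniteDimensional K W] :
    ∃ f ∈ Fset K, Function.Surjective ⇑(derOp K ^ Module.finrank K W + f) ∧
      LinearMap.ker (derOp K ^ Module.finrank K W + f) = W := by
  obtain ⟨N, hN⟩ := exists_le_degreeLT W
  set n := Module.finrank K W with hn
  obtain ⟨M, rfl⟩ : ∃ M, N = n + M := Nat.exists_eq_add_of_le (by
    rw [← finrank_degreeLT (K := K) N]; exact Submodule.finrank_mono hN)
  set W' := W.comap (degreeLT K (n + M)).subtype with hW'
  have hfin : Module.finrank K W' = n := (Submodule.comapSubtypeEquivOfLe hN).finrank_eq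
  have hquot : Module.finrank K (degreeLT K (n + M) ⧸ W') =
      Module.finrank K (degreeLT K M) := by
    have := W'.finrank_quotient_add_finrank
    rw [finrank_degreeLT] at this ⊢
    omega
  let φ := LinearEquiv.ofFinrankEq _ _ hquot
  let β : degreeLT K (n + M) →ₗ[K] Polynomial K :=
    (degreeLT K M).subtype ∘ₗ φ.toLinearMap ∘ₗ W'.mkQ
  let f : Module.End K (Polynomial K) :=
    (β - (derOp K ^ n) ∘ₗ (degreeLT K (n + M)).subtype) ∘ₗ truncOp K (n + M)
  have hker : ∀ r, β r = 0 ↔ (r : Polynomial K) ∈ W := fun r => by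
    simp [β, hW']
  have happ : ∀ p, (derOp K ^ n + f) p =
      β (truncOp K (n + M) p) + (intOp K ^ M) ((derOp K ^ (n + M)) p) := fun p => by
    have : (f p) = β (truncOp K (n + M) p) - (derOp K ^ n) (truncOp K (n + M) p) := rfl
    rw [LinearMap.add_apply, this, coe_truncOp, map_sub, pow_add (intOp K), Module.End.mul_apply,
      derOp_pow_intOp_pow]
    abel
  refine ⟨f, mem_Fset_of_mul_intOp_pow (N := n + M) ?_, fun q => ?_, ?_⟩
  · refine LinearMap.ext fun p => ?_
    rw [Module.End.mul_apply]
    change (β - (derOp K ^ n) ∘ₗ (degreeLT K (n + M)).subtype) (truncOp K (n + M) _) = 0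
    rw [truncOp_intOp_pow, map_zero]
  · obtain ⟨r, hr⟩ := W'.mkQ_surjective (φ.symm (truncOp K M q))
    refine ⟨r + (intOp K ^ (n + M)) ((derOp K ^ M) q), ?_⟩
    have hβ : β r = truncOp K M q := by simp [β, hr]
    rw [happ, truncOp_coe_add, hβ, coe_truncOp, map_add, mem_degreeLT_iff_derOp_pow.mp r.2,
      zero_add, derOp_pow_intOp_pow, sub_add_cancel]
  · ext p
    rw [LinearMap.mem_ker, happ]
    constructor
    · intro h
      have h0 : (derOp K ^ (n + M)) p = 0 := by
        have := congrArg (derOp K ^ M) h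
        have hβ : (derOp K ^ M) (β (truncOp K (n + M) p)) = 0 :=
          mem_degreeLT_iff_derOp_pow.mp (φ (W'.mkQ (truncOp K (n + M) p))).2
        rwa [map_add, map_zero, derOp_pow_intOp_pow, hβ, zero_add] at this
      rw [h0, map_zero, add_zero, hker, coe_truncOp, h0, map_zero, sub_zero] at h
      exact h
    · intro h
      have h0 := mem_degreeLT_iff_derOp_pow.mp (hN h)
      rw [h0, map_zero, add_zero, hker, coe_truncOp, h0, map_zero, sub_zero]
      exact h

lemma exists_injective_isCompl_range (W : Submodule K (Polynomial K)) [FiniteDimensional K W] :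
    ∃ g ∈ Fset K, Function.Injective ⇑(intOp K ^ Module.finrank K W + g) ∧
      IsCompl W (LinearMap.range (intOp K ^ Module.finrank K W + g)) := by
  obtain ⟨N, hN⟩ := exists_le_degreeLT W
  set n := Module.finrank K W with hn
  obtain ⟨M, rfl⟩ : ∃ M, N = n + M := Nat.exists_eq_add_of_le (by
    rw [← finrank_degreeLT (K := K) N]; exact Submodule.finrank_mono hN)
  set W' := W.comap (degreeLT K (n + M)).subtype with hW'
  have hfin : Module.finrank K W' = n := (Submodule.comapSubtypeEquivOfLe hN).finrank_eq
  obtain ⟨U, hU⟩ := W'.exists_isCompl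
  have hfinU : Module.finrank K (degreeLT K M) = Module.finrank K U := by
    have := Submodule.finrank_add_eq_of_isCompl hU
    rw [finrank_degreeLT] at this ⊢
    omega
  have : Module.Free K U := Module.Free.of_divisionRing K U
  let φ : degreeLT K M ≃ₗ[K] U := LinearEquiv.ofFinrankEq _ _ hfinU
  let γ : degreeLT K M →ₗ[K] Polynomial K :=
    (degreeLT K (n + M)).subtype ∘ₗ U.subtype ∘ₗ φ.toLinearMap
  let g : Module.End K (Polynomial K) :=
    (γ - (intOp K ^ n) ∘ₗ (degreeLT K M).subtype) ∘ₗ truncOp K M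
  have hγ : ∀ r, (derOp K ^ (n + M)) (γ r) = 0 := fun r =>
    mem_degreeLT_iff_derOp_pow.mp (φ r).1.2
  have happ : ∀ p, (intOp K ^ n + g) p =
      γ (truncOp K M p) + (intOp K ^ (n + M)) ((derOp K ^ M) p) := fun p => by
    have : (g p) = γ (truncOp K M p) - (intOp K ^ n) (truncOp K M p) := rfl
    rw [LinearMap.add_apply, this, coe_truncOp, map_sub, pow_add (intOp K), Module.End.mul_apply]
    abel
  have htop : ∀ p, (derOp K ^ (n + M)) ((intOp K ^ n + g) p) = (derOp K ^ M) p := fun p => by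
    rw [happ, map_add, hγ, zero_add, derOp_pow_intOp_pow]
  refine ⟨g, mem_Fset_of_mul_intOp_pow (N := M) ?_, ?_, ?_, ?_⟩
  · refine LinearMap.ext fun p => ?_
    rw [Module.End.mul_apply]
    change (γ - (intOp K ^ n) ∘ₗ (degreeLT K M).subtype) (truncOp K M _) = 0
    rw [truncOp_intOp_pow, map_zero]
  · rw [injective_iff_map_eq_zero]
    intro p hp
    have h0 : (derOp K ^ M) p = 0 := by rw [← htop, hp, map_zero]
    rw [happ, h0, map_zero, add_zero] at hp
    have h1 : truncOp K M p = 0 := by simpa [γ] using hp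
    have h2 := coe_truncOp M p
    rw [h1, h0, map_zero, sub_zero] at h2
    exact h2.symm
  · rw [Submodule.disjoint_def]
    rintro _ hw ⟨p, rfl⟩
    have h0 : (derOp K ^ M) p = 0 := by rw [← htop, mem_degreeLT_iff_derOp_pow.mp (hN hw)]
    rw [happ, h0, map_zero, add_zero] at hw ⊢
    have h1 := Submodule.disjoint_def.mp hU.disjoint (φ (truncOp K M p)).1 hw
      (φ (truncOp K M p)).2
    exact congrArg Subtype.val h1
  · rw [codisjoint_iff, eq_top_iff]
    intro q _
    obtain ⟨w, hw, u, hu, hwu⟩ := Submodule.mem_sup.mp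
      (hU.sup_eq_top ▸ Submodule.mem_top : truncOp K (n + M) q ∈ W' ⊔ U)
    refine Submodule.mem_sup.mpr ⟨w, hw, _, LinearMap.mem_range_self _
      ((φ.symm ⟨u, hu⟩ : degreeLT K M) + (intOp K ^ M) ((derOp K ^ (n + M)) q)), ?_⟩
    have hγu : γ (φ.symm ⟨u, hu⟩) = u := by simp [γ]
    have hsum : (w : Polynomial K) + u = q - (intOp K ^ (n + M)) ((derOp K ^ (n + M)) q) := by
      rw [← coe_truncOp, ← hwu, Submodule.coe_add]
    rw [happ, truncOp_coe_add, hγu, map_add, mem_degreeLT_iff_derOp_pow.mp (φ.symm ⟨u, hu⟩).2,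
      zero_add, derOp_pow_intOp_pow, ← add_assoc, hsum, sub_add_cancel]

/-! ### Composition with complements -/

section Compl

variable {V : Type*} [AddCommGroup V] [Module K V] {a b c : Module.End K V}

lemma ker_mul_of_disjoint (h : Disjoint (LinearMap.range a) (LinearMap.ker b)) :
    LinearMap.ker (b * a) = LinearMap.ker a := by
  ext p
  refine ⟨fun hp => ?_, fun hp => ?_⟩
  · exact Submodule.disjoint_def.mp h (a p) (LinearMap.mem_range_self a p) hp
  · rw [LinearMap.mem_ker, Module.End.mul_apply, LinearMap.mem_ker.mp hp, map_zero]

lemma range_mul_of_codisjoint (h : Codisjoint (LinearMap.ker a) (LinearMap.range c)) :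
    LinearMap.range (a * c) = LinearMap.range a := by
  refine le_antisymm (LinearMap.range_comp_le_range c a) ?_
  rintro _ ⟨p, rfl⟩
  obtain ⟨w, hw, q, ⟨r, rfl⟩, rfl⟩ := Submodule.mem_sup.mp
    (h.eq_top ▸ Submodule.mem_top : p ∈ LinearMap.ker a ⊔ LinearMap.range c)
  exact ⟨r, by rw [map_add, LinearMap.mem_ker.mp hw, zero_add, Module.End.mul_apply]⟩

lemma injective_mul_of_disjoint (hc : Function.Injective c)
    (h : Disjoint (LinearMap.ker a) (LinearMap.range c)) : Function.Injective ⇑(a * c) := by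
  rw [← LinearMap.ker_eq_bot, ker_mul_of_disjoint h.symm, LinearMap.ker_eq_bot]
  exact hc

lemma surjective_mul_of_codisjoint (hb : Function.Surjective b)
    (h : Codisjoint (LinearMap.ker b) (LinearMap.range a)) : Function.Surjective ⇑(b * a) := by
  rw [← LinearMap.range_eq_top, range_mul_of_codisjoint h, LinearMap.range_eq_top]
  exact hb

end Compl
/-- for `a ∈ I₁ \ F` one can correct `a` by powers of `∂` and `∫` plus
compact operators to make it surjective, injective, or bijective on `K[x]`, without
changing kernel/image respectively. -/
theorem statement17 (a : Module.End K (Polynomial K)) (haI : a ∈ I1 K)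
    (haF : a ∉ Fset K) :
    (∃ f ∈ Fset K,
        Function.Surjective
          ⇑((derOp K ^ (Module.finrank K (Polynomial K ⧸ LinearMap.range a)) + f) * a)
        ∧ LinearMap.ker
            ((derOp K ^ (Module.finrank K (Polynomial K ⧸ LinearMap.range a)) + f) * a)
          = LinearMap.ker a)
    ∧ (∃ g ∈ Fset K,
        Function.Injective
          ⇑(a * (intOp K ^ (Module.finrank K ↥(LinearMap.ker a)) + g))
        ∧ LinearMap.range (a * (intOp K ^ (Module.finrank K ↥(LinearMap.ker a)) + g))
          = LinearMap.range a)
    ∧ (∃ f ∈ Fset K, ∃ g ∈ Fset K,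
        Function.Bijective
          ⇑((derOp K ^ (Module.finrank K (Polynomial K ⧸ LinearMap.range a)) + f) * a *
            (intOp K ^ (Module.finrank K ↥(LinearMap.ker a)) + g))) := by
  have := finiteDimensional_coker haI haF
  have := finiteDimensional_ker haI haF
  obtain ⟨W, hW⟩ := (LinearMap.range a).exists_isCompl
  have e := Submodule.quotientEquivOfIsCompl _ W hW
  have : FiniteDimensional K W := e.finiteDimensional
  obtain ⟨f, hf, hfsurj, hfker⟩ := exists_surjective_ker_eq W
  obtain ⟨g, hg, hginj, hgcompl⟩ := exists_injective_isCompl_range (LinearMap.ker a)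
  rw [← e.finrank_eq] at hfsurj hfker
  rw [← hfker] at hW
  have hrange := range_mul_of_codisjoint hgcompl.codisjoint
  have hinj := injective_mul_of_disjoint hginj hgcompl.disjoint
  refine ⟨⟨f, hf, surjective_mul_of_codisjoint hfsurj hW.symm.codisjoint,
    ker_mul_of_disjoint hW.disjoint⟩, ⟨g, hg, hinj, hrange⟩, f, hf, g, hg, ?_⟩
  rw [mul_assoc]
  refine ⟨injective_mul_of_disjoint hinj ?_, surjective_mul_of_codisjoint hfsurj ?_⟩
  · rw [hrange]
    exact hW.symm.disjoint
  · rw [hrange]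
    exact hW.symm.codisjoint

end
end

section
/- Let I₁⁰ := I₁ ∩ Aut_K(K[x]) be the set of elements of I₁ that act bijectively on K[x]. Then: (1) every element of I₁⁰ is a regular element of I₁, and I₁⁰ is a multiplicatively closed set satisfying the right Ore condition in I₁ (for all a ∈ I₁ and s ∈ I₁⁰ there exist b ∈ I₁ and t ∈ I₁⁰ with at = sb); (2) I₁⁰ is the largest such set: every multiplicatively closed subset S of regular elements of I₁ satisfying the right Ore condition is contained in I₁⁰; (3) consequently, the set of all regular elements of I₁ satisfies neither the right Ore condition nor the left Ore condition, so neither the classical right quotient ring nor the classical left quotient ring of I₁ exists. -/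
open Polynomial

noncomputable section
set_option synthInstance.maxHeartbeats 1000000
set_option maxHeartbeats 1000000
set_option linter.unusedSectionVars false

variable (K : Type*) [Field K] [CharZero K]

/-- `I₁⁰ := I₁ ∩ Aut_K(K[x])`, the set of elements of `I₁` acting bijectively on `K[x]`. -/
def I10 : Set (I1 K) := {a : I1 K | Function.Bijective ⇑(a : Module.End K (Polynomial K))}

/-! ### The divided power basis `xⁿ / n!` and its coordinates -/

/-- The divided power `xⁿ / n!`. -/
def dpow (n : ℕ) : Polynomial K := Polynomial.monomial n ((n.factorial : K)⁻¹)

/-- The `l`-th coordinate with respect to the divided powers. -/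
def dcoord (l : ℕ) : Polynomial K →ₗ[K] K := (l.factorial : K) • Polynomial.lcoeff K l

variable {K}

lemma dcoord_apply (l : ℕ) (p : Polynomial K) :
    dcoord K l p = (l.factorial : K) * p.coeff l := by
  simp [dcoord]

lemma dcoord_dpow (l m : ℕ) : dcoord K l (dpow K m) = if l = m then 1 else 0 := by
  rw [dcoord_apply, dpow, Polynomial.coeff_monomial]
  split_ifs with h1 h2 h2
  · subst h1
    exact mul_inv_cancel₀ (Nat.cast_ne_zero.2 (Nat.factorial_ne_zero _))
  · exact absurd h1.symm h2
  · exact absurd h2.symm h1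
  · simp

lemma ext_dcoord {p q : Polynomial K} (h : ∀ l, dcoord K l p = dcoord K l q) : p = q := by
  ext l
  have := h l
  rw [dcoord_apply, dcoord_apply] at this
  exact mul_left_cancel₀ (Nat.cast_ne_zero.2 l.factorial_ne_zero) this

lemma dcoord_eq_zero_of_natDegree_lt {l : ℕ} {p : Polynomial K} (h : p.natDegree < l) :
    dcoord K l p = 0 := by
  rw [dcoord_apply, Polynomial.coeff_eq_zero_of_natDegree_lt h, mul_zero]

lemma degree_dpow (n : ℕ) : (dpow K n).degree = n :=
  Polynomial.degree_monomial n (inv_ne_zero (Nat.cast_ne_zero.2 n.factorial_ne_zero))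

lemma ext_dpow {M : Type*} [AddCommGroup M] [Module K M] {f g : Polynomial K →ₗ[K] M}
    (h : ∀ m, f (dpow K m) = g (dpow K m)) : f = g := by
  refine Polynomial.lhom_ext' fun n => LinearMap.ext_ring ?_
  have h1 : Polynomial.monomial n (1 : K) = (n.factorial : K) • dpow K n := by
    rw [dpow, Polynomial.smul_monomial, smul_eq_mul,
      mul_inv_cancel₀ (Nat.cast_ne_zero.2 n.factorial_ne_zero)]
  simp [h1, h]

variable (K) in
/-- The divided powers as a basis of `K[x]`. -/
def dpowBasis : Module.Basis ℕ K (Polynomial K) :=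
  Polynomial.Sequence.basis ⟨dpow K, degree_dpow⟩ fun i => by
    rw [isUnit_iff_ne_zero, Ne, Polynomial.leadingCoeff_eq_zero]
    exact Polynomial.Sequence.ne_zero _ i

lemma dpowBasis_apply (n : ℕ) : dpowBasis K n = dpow K n := by
  simp [dpowBasis]

/-! ### The generators in coordinates -/

lemma dcoord_derOp (l : ℕ) (p : Polynomial K) :
    dcoord K l (derOp K p) = dcoord K (l + 1) p := by
  rw [dcoord_apply, dcoord_apply, derOp, Polynomial.coeff_derivative, Nat.factorial_succ]
  push_cast
  ring

lemma dcoord_succ_xOp (l : ℕ) (p : Polynomial K) :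
    dcoord K (l + 1) (xOp K p) = (l + 1) * dcoord K l p := by
  rw [dcoord_apply, dcoord_apply, xOp, LinearMap.mulLeft_apply, Polynomial.coeff_X_mul,
    Nat.factorial_succ]
  push_cast
  ring

lemma dcoord_zero_xOp (p : Polynomial K) : dcoord K 0 (xOp K p) = 0 := by
  rw [dcoord_apply, xOp, LinearMap.mulLeft_apply, Polynomial.coeff_X_mul_zero, mul_zero]

lemma intOp_dpow (m : ℕ) : intOp K (dpow K m) = dpow K (m + 1) := by
  have h : dpow K m = (m.factorial : K)⁻¹ • Polynomial.basisMonomials K m := by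
    rw [Polynomial.coe_basisMonomials, Polynomial.smul_monomial, smul_eq_mul, mul_one, dpow]
  rw [h, map_smul, intOp, Module.Basis.constr_basis, smul_smul,
    ← Polynomial.monomial_one_right_eq_X_pow, Polynomial.smul_monomial, dpow, Nat.factorial_succ]
  push_cast
  rw [mul_inv, smul_eq_mul, mul_one, mul_comm]

lemma dcoord_succ_intOp (l : ℕ) (p : Polynomial K) :
    dcoord K (l + 1) (intOp K p) = dcoord K l p := by
  have : (dcoord K (l + 1)) ∘ₗ (intOp K) = dcoord K l := ext_dpow fun m => by
    simp [intOp_dpow, dcoord_dpow]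
  exact LinearMap.congr_fun this p

lemma dcoord_zero_intOp (p : Polynomial K) : dcoord K 0 (intOp K p) = 0 := by
  have : (dcoord K 0) ∘ₗ (intOp K) = 0 := ext_dpow fun m => by
    simp [intOp_dpow, dcoord_dpow]
  exact LinearMap.congr_fun this p

lemma derOp_dpow_zero : derOp K (dpow K 0) = 0 :=
  ext_dcoord fun l => by simp [dcoord_derOp, dcoord_dpow]

lemma derOp_dpow_succ (m : ℕ) : derOp K (dpow K (m + 1)) = dpow K m :=
  ext_dcoord fun l => by simp [dcoord_derOp, dcoord_dpow]

lemma derOp_pow_dpow_add (m e : ℕ) : (derOp K ^ e) (dpow K (m + e)) = dpow K m := by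
  induction e with
  | zero => simp
  | succ e ih => rw [pow_succ, Module.End.mul_apply, ← add_assoc, derOp_dpow_succ, ih]

lemma intOp_pow_dpow (m i : ℕ) : (intOp K ^ i) (dpow K m) = dpow K (m + i) := by
  induction i with
  | zero => simp
  | succ i ih => rw [pow_succ', Module.End.mul_apply, ih, intOp_dpow, add_assoc]

lemma xOp_derOp_dpow (m : ℕ) : (xOp K * derOp K) (dpow K m) = (m : K) • dpow K m := by
  refine ext_dcoord fun l => ?_
  rw [Module.End.mul_apply, map_smul, smul_eq_mul, dcoord_dpow]
  cases l with
  | zero =>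
    rw [dcoord_zero_xOp]
    split_ifs with h
    · simp [← h]
    · simp
  | succ l =>
    rw [dcoord_succ_xOp, dcoord_derOp, dcoord_dpow]
    split_ifs with h
    · simp [← h]
    · simp

/-! ### Operators with finitely many nonzero columns -/

lemma dcoord_derOp_pow (j l : ℕ) (p : Polynomial K) :
    dcoord K l ((derOp K ^ j) p) = dcoord K (l + j) p := by
  induction j generalizing l with
  | zero => simp
  | succ j ih => rw [pow_succ', Module.End.mul_apply, dcoord_derOp, ih, add_right_comm, add_assoc]

lemma dcoord_intOp_pow (i l : ℕ) (p : Polynomial K) :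
    dcoord K l ((intOp K ^ i) p) = if i ≤ l then dcoord K (l - i) p else 0 := by
  induction i generalizing l with
  | zero => simp
  | succ i ih =>
    rw [pow_succ', Module.End.mul_apply]
    cases l with
    | zero => simp [dcoord_zero_intOp]
    | succ l => simp [dcoord_succ_intOp, ih]

lemma eOp_apply (i j : ℕ) (p : Polynomial K) : eOp K i j p = dcoord K j p • dpow K i := by
  refine ext_dcoord fun l => ?_
  rw [eOp, LinearMap.sub_apply, map_sub, Module.End.mul_apply, Module.End.mul_apply,
    dcoord_intOp_pow, dcoord_intOp_pow, dcoord_derOp_pow, dcoord_derOp_pow, map_smul, dcoord_dpow]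
  rcases lt_trichotomy l i with h | rfl | h
  · simp [h.not_ge, h.ne, show ¬ i + 1 ≤ l by omega]
  · simp
  · simp [h.le, h.ne', show i + 1 ≤ l by omega, show l - (i + 1) + (j + 1) = l - i + j by omega]

lemma smulRight_mem_I1 (j : ℕ) (v : Polynomial K) : (dcoord K j).smulRight v ∈ I1 K := by
  have hv := (dpowBasis K).mem_span v
  induction hv using Submodule.span_induction with
  | mem v hv =>
    obtain ⟨i, rfl⟩ := hv
    have h : (dcoord K j).smulRight (dpowBasis K i) = eOp K i j := LinearMap.ext fun p => by
      rw [LinearMap.smulRight_apply, eOp_apply, dpowBasis_apply]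
    exact h ▸ eOp_mem K i j
  | zero =>
    have h : (dcoord K j).smulRight (0 : Polynomial K) = 0 := LinearMap.ext fun p => by simp
    exact h ▸ (I1 K).zero_mem
  | add v w _ _ hv hw =>
    have h : (dcoord K j).smulRight (v + w) = (dcoord K j).smulRight v + (dcoord K j).smulRight w :=
      LinearMap.ext fun p => by simp
    exact h ▸ add_mem hv hw
  | smul c v _ hv =>
    have h : (dcoord K j).smulRight (c • v) = c • (dcoord K j).smulRight v :=
      LinearMap.ext fun p => by simp [smul_comm c]
    exact h ▸ (I1 K).smul_mem hv c

lemma mem_I1_of_apply_dpow_eq_zero {h : Module.End K (Polynomial K)} {M : ℕ}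
    (hM : ∀ m ≥ M, h (dpow K m) = 0) : h ∈ I1 K := by
  have : h = ∑ m ∈ Finset.range M, (dcoord K m).smulRight (h (dpow K m)) := ext_dpow fun m => by
    simp only [LinearMap.sum_apply, LinearMap.smulRight_apply, dcoord_dpow, ite_smul, one_smul,
      zero_smul, Finset.sum_ite_eq', Finset.mem_range]
    split_ifs with hm
    · rfl
    · exact hM m (not_lt.1 hm)
  rw [this]
  exact sum_mem fun m _ => smulRight_mem_I1 m _

/-! ### Symbols of elements of `I₁` -/

/-- On almost all columns the matrix of `a` with respect to the divided powers is banded, and its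
entries along each diagonal are the values of a polynomial. -/
def HasSymbol (a : Module.End K (Polynomial K)) (P : ℤ → Polynomial K) (d M : ℕ) : Prop :=
  (∀ k : ℤ, d < k.natAbs → P k = 0) ∧
    ∀ m ≥ M, ∀ l : ℕ, dcoord K l (a (dpow K m)) = (P (l - m)).eval (m : K)

lemma HasSymbol.mono {a : Module.End K (Polynomial K)} {P : ℤ → Polynomial K} {d d' M M' : ℕ}
    (h : HasSymbol a P d M) (hd : d ≤ d') (hM : M ≤ M') : HasSymbol a P d' M' :=
  ⟨fun k hk => h.1 k (by omega), fun m hm => h.2 m (by omega)⟩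

lemma hasSymbol_one : HasSymbol (1 : Module.End K (Polynomial K)) (Pi.single 0 1) 0 0 := by
  refine ⟨fun k hk => Pi.single_eq_of_ne (by simpa using hk) _, fun m _ l => ?_⟩
  rw [Module.End.one_apply, dcoord_dpow]
  split_ifs with h
  · simp [h]
  · rw [Pi.single_eq_of_ne (by omega)]
    simp

lemma HasSymbol.add {a b : Module.End K (Polynomial K)} {P Q : ℤ → Polynomial K} {d M : ℕ}
    (ha : HasSymbol a P d M) (hb : HasSymbol b Q d M) : HasSymbol (a + b) (P + Q) d M :=
  ⟨fun k hk => by simp [ha.1 k hk, hb.1 k hk],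
    fun m hm l => by simp [ha.2 m hm l, hb.2 m hm l]⟩

lemma HasSymbol.smul {a : Module.End K (Polynomial K)} {P : ℤ → Polynomial K} {d M : ℕ}
    (ha : HasSymbol a P d M) (c : K) : HasSymbol (c • a) (c • P) d M :=
  ⟨fun k hk => by simp [ha.1 k hk], fun m hm l => by simp [ha.2 m hm l]⟩

lemma HasSymbol.derOp_mul {a : Module.End K (Polynomial K)} {P : ℤ → Polynomial K} {d M : ℕ}
    (ha : HasSymbol a P d M) : HasSymbol (derOp K * a) (fun k => P (k + 1)) (d + 1) M := by
  refine ⟨fun k hk => ha.1 _ (by omega), fun m hm l => ?_⟩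
  rw [Module.End.mul_apply, dcoord_derOp, ha.2 m hm]
  push_cast
  ring_nf

lemma HasSymbol.intOp_mul {a : Module.End K (Polynomial K)} {P : ℤ → Polynomial K} {d M : ℕ}
    (ha : HasSymbol a P d M) :
    HasSymbol (intOp K * a) (fun k => P (k - 1)) (d + 1) (max M d) := by
  refine ⟨fun k hk => ha.1 _ (by omega), fun m hm l => ?_⟩
  rw [Module.End.mul_apply]
  cases l with
  | zero =>
    beta_reduce
    rw [dcoord_zero_intOp, ha.1 _ (by omega), Polynomial.eval_zero]
  | succ l =>
    rw [dcoord_succ_intOp, ha.2 m (by omega)]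
    push_cast
    ring_nf

lemma HasSymbol.xOp_mul {a : Module.End K (Polynomial K)} {P : ℤ → Polynomial K} {d M : ℕ}
    (ha : HasSymbol a P d M) :
    HasSymbol (xOp K * a) (fun k => (X + C (k : K)) * P (k - 1)) (d + 1) M := by
  refine ⟨fun k hk => by simp [ha.1 (k - 1) (by omega)], fun m hm l => ?_⟩
  rw [Module.End.mul_apply]
  cases l with
  | zero => simp [dcoord_zero_xOp]
  | succ l =>
    beta_reduce
    rw [dcoord_succ_xOp, ha.2 m hm, show ((l + 1 : ℕ) : ℤ) - m - 1 = l - m by push_cast; ring]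
    simp

lemma exists_hasSymbol_mul {a : Module.End K (Polynomial K)} (ha : a ∈ I1 K) :
    ∀ b : Module.End K (Polynomial K), (∃ P d M, HasSymbol b P d M) →
      ∃ P d M, HasSymbol (a * b) P d M := by
  induction ha using Algebra.adjoin_induction with
  | mem a ha =>
    rintro b ⟨P, d, M, hb⟩
    rcases ha with rfl | rfl | rfl
    · exact ⟨_, _, _, hb.xOp_mul⟩
    · exact ⟨_, _, _, hb.derOp_mul⟩
    · exact ⟨_, _, _, hb.intOp_mul⟩
  | algebraMap r =>
    rintro b ⟨P, d, M, hb⟩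
    rw [← Algebra.smul_def]
    exact ⟨_, _, _, hb.smul r⟩
  | add a a' _ _ h h' =>
    intro b hb
    obtain ⟨P, d, M, h⟩ := h b hb
    obtain ⟨P', d', M', h'⟩ := h' b hb
    rw [add_mul]
    exact ⟨_, _, _, (h.mono (le_max_left d d') (le_max_left M M')).add
      (h'.mono (le_max_right d d') (le_max_right M M'))⟩
  | mul a a' _ _ h h' =>
    intro b hb
    rw [mul_assoc]
    exact h _ (h' _ hb)

lemma exists_hasSymbol {a : Module.End K (Polynomial K)} (ha : a ∈ I1 K) :
    ∃ P d M, HasSymbol a P d M := by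
  simpa using exists_hasSymbol_mul ha 1 ⟨_, _, _, hasSymbol_one⟩

lemma eq_zero_of_apply_dpow_eq {b : Module.End K (Polynomial K)} (hb : b ∈ I1 K)
    {v : Polynomial K} (h : ∀ m, b (dpow K m) = v) : v = 0 := by
  obtain ⟨P, d, M, hs⟩ := exists_hasSymbol hb
  refine ext_dcoord fun l => ?_
  rw [← h (max M (l + d + 1)), hs.2 _ (le_max_left _ _), hs.1 _ (by omega), map_zero,
    Polynomial.eval_zero]

/-! ### Triangular operators -/

lemma bijective_of_degree_eq {u : Module.End K (Polynomial K)}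
    (hu : ∀ m, (u (dpow K m)).degree = m) : Function.Bijective u := by
  let S : Polynomial.Sequence K := ⟨fun m => u (dpow K m), hu⟩
  have hS : ∀ i, IsUnit (S i).leadingCoeff := fun i => by
    rw [isUnit_iff_ne_zero, Ne, Polynomial.leadingCoeff_eq_zero]
    exact S.ne_zero i
  have h : u = ((dpowBasis K).equiv (S.basis hS) (Equiv.refl ℕ) : Polynomial K →ₗ[K] _) :=
    ext_dpow fun m => by
      rw [← dpowBasis_apply, LinearEquiv.coe_coe, Module.Basis.equiv_apply, Equiv.refl_apply,
        Polynomial.Sequence.basis_eq_self, dpowBasis_apply]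
  rw [h]
  exact ((dpowBasis K).equiv (S.basis hS) (Equiv.refl ℕ)).bijective

/-- The operator `∑ i < n, ∫^i T_i(x∂)`. -/
def shiftOp {n : ℕ} (T : Fin n → Polynomial K) : Module.End K (Polynomial K) :=
  ∑ i : Fin n, intOp K ^ (i : ℕ) * Polynomial.aeval (xOp K * derOp K) (T i)

lemma shiftOp_mem {n : ℕ} (T : Fin n → Polynomial K) : shiftOp T ∈ I1 K :=
  sum_mem fun _ _ => mul_mem (pow_mem (intOp_mem K) _)
    (Algebra.adjoin_le (Set.singleton_subset_iff.2 (mul_mem (xOp_mem K) (derOp_mem K)))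
      (Polynomial.aeval_mem_adjoin_singleton K _))

lemma shiftOp_dpow {n : ℕ} (T : Fin n → Polynomial K) (m : ℕ) :
    shiftOp T (dpow K m) = ∑ i : Fin n, (T i).eval (m : K) • dpow K (m + i) := by
  simp only [shiftOp, LinearMap.sum_apply, Module.End.mul_apply]
  refine Finset.sum_congr rfl fun i _ => ?_
  rw [Module.End.aeval_apply_of_mem_apply_eq_smul (xOp_derOp_dpow m), map_smul,
    intOp_pow_dpow]

lemma exists_forall_eval_ne_zero {p : Polynomial K} (hp : p ≠ 0) :
    ∃ M : ℕ, ∀ m ≥ M, p.eval (m : K) ≠ 0 := by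
  have hfin : {m : ℕ | p.eval (m : K) = 0}.Finite :=
    (Polynomial.finite_setOfPred_isRoot hp).preimage Nat.cast_injective.injOn
  obtain ⟨M, hM⟩ := hfin.bddAbove
  exact ⟨M + 1, fun m hm h => absurd (hM h) (by omega)⟩

lemma degree_sum_smul_dpow {n : ℕ} (c : Fin n → K) (m : ℕ) (e : Fin n) (he : c e ≠ 0)
    (hc : ∀ i, e < i → c i = 0) : (∑ i, c i • dpow K (m + i)).degree = (m + e : ℕ) := by
  have h1 : ∀ i : Fin n, i ≠ e → (c i • dpow K (m + i)).degree < (m + e : ℕ) := fun i hi => by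
    rcases lt_or_gt_of_ne hi with h | h
    · refine (Polynomial.degree_smul_le _ _).trans_lt ?_
      rw [degree_dpow]
      exact_mod_cast (by omega : m + (i : ℕ) < m + e)
    · rw [hc i h, zero_smul, Polynomial.degree_zero]
      exact WithBot.bot_lt_coe _
  have h2 : (c e • dpow K (m + e)).degree = (m + e : ℕ) := by
    rw [Polynomial.degree_smul_of_smul_regular _ (IsSMulRegular.of_ne_zero he), degree_dpow]
  rw [← Finset.add_sum_erase _ _ (Finset.mem_univ e),
    Polynomial.degree_add_eq_left_of_degree_lt, h2]
  rw [h2]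
  refine (Polynomial.degree_sum_le _ _).trans_lt ?_
  rw [Finset.sup_lt_iff (WithBot.bot_lt_coe _)]
  exact fun i hi => h1 i (Finset.ne_of_mem_erase hi)

/-- A nonzero operator `shiftOp T` becomes bijective after multiplication by a power of `∂` and a
modification of finitely many columns. -/
lemma exists_bijective_modification {n : ℕ} {T : Fin n → Polynomial K} (hT : T ≠ 0) :
    ∃ (e : ℕ) (u : Module.End K (Polynomial K)), u ∈ I1 K ∧ Function.Bijective u ∧
      ∃ M, ∀ m ≥ M, u (dpow K m) = (shiftOp T * derOp K ^ e) (dpow K m) := by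
  classical
  obtain ⟨i₀, hi₀⟩ := Function.ne_iff.1 hT
  obtain ⟨e, he, hmax⟩ := Finset.exists_max_image (Finset.univ.filter fun i => T i ≠ 0) id
    ⟨i₀, by simpa using hi₀⟩
  simp only [Finset.mem_filter, Finset.mem_univ, true_and, id] at he hmax
  obtain ⟨M, hM⟩ := exists_forall_eval_ne_zero he
  let u : Module.End K (Polynomial K) := (dpowBasis K).constr K fun m =>
    if m < M + e then dpow K m else (shiftOp T * derOp K ^ (e : ℕ)) (dpow K m)
  have hu : ∀ m, u (dpow K m) =
      if m < M + e then dpow K m else (shiftOp T * derOp K ^ (e : ℕ)) (dpow K m) := fun m => by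
    rw [← dpowBasis_apply, Module.Basis.constr_basis, dpowBasis_apply]
  have hlarge : ∀ m ≥ M + e, u (dpow K m) = (shiftOp T * derOp K ^ (e : ℕ)) (dpow K m) :=
    fun m hm => by rw [hu, if_neg (by omega)]
  refine ⟨e, u, ?_, bijective_of_degree_eq fun m => ?_, M + e, hlarge⟩
  · have h1 : u - shiftOp T * derOp K ^ (e : ℕ) ∈ I1 K :=
      mem_I1_of_apply_dpow_eq_zero (M := M + e) fun m hm => by
        rw [LinearMap.sub_apply, hlarge m hm, sub_self]
    simpa using add_mem h1 (mul_mem (shiftOp_mem T) (pow_mem (derOp_mem K) e))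
  · by_cases hm : m < M + e
    · rw [hu, if_pos hm, degree_dpow]
    · obtain ⟨k, rfl⟩ := Nat.exists_eq_add_of_le'
        ((Nat.le_add_left _ _).trans (not_lt.1 hm))
      rw [hu, if_neg hm, Module.End.mul_apply, derOp_pow_dpow_add, shiftOp_dpow]
      refine degree_sum_smul_dpow _ k e (hM k (by omega)) fun i hi => ?_
      have : T i = 0 := by
        by_contra h
        exact absurd (hmax i h) (not_le.2 hi)
      rw [this, Polynomial.eval_zero]

/-! ### The right Ore condition up to finitely many columns -/

lemma dcoord_mul_shiftOp {a : Module.End K (Polynomial K)} {P : ℤ → Polynomial K} {d M n : ℕ}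
    (ha : HasSymbol a P d M) (T : Fin n → Polynomial K) {m : ℕ} (hm : M ≤ m) (l : ℕ) :
    dcoord K l ((a * shiftOp T) (dpow K m)) =
      (∑ i : Fin n, (P (l - m - (i : ℕ))).comp (X + C ((i : ℕ) : K)) * T i).eval (m : K) := by
  rw [Module.End.mul_apply, shiftOp_dpow, map_sum, map_sum, Polynomial.eval_finsetSum]
  refine Finset.sum_congr rfl fun i _ => ?_
  rw [map_smul, map_smul, ha.2 _ (by omega)]
  simp [mul_comm, sub_sub]

lemma exists_mul_shiftOp_eq {a s : Module.End K (Polynomial K)} (ha : a ∈ I1 K) (hs : s ∈ I1 K) :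
    ∃ (n M : ℕ) (T B : Fin n → Polynomial K), (T ≠ 0 ∨ B ≠ 0) ∧
      ∀ m ≥ M, (a * shiftOp T) (dpow K m) = (s * shiftOp B) (dpow K m) := by
  obtain ⟨P, d₁, M₁, hP⟩ := exists_hasSymbol ha
  obtain ⟨Q, d₂, M₂, hQ⟩ := exists_hasSymbol hs
  obtain ⟨d, hd⟩ : ∃ d, d = max d₁ d₂ := ⟨_, rfl⟩
  replace hP := hP.mono (hd ▸ le_max_left d₁ d₂) (le_max_left M₁ M₂)
  replace hQ := hQ.mono (hd ▸ le_max_right d₁ d₂) (le_max_right M₁ M₂)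
  let A : Matrix (Fin (4 * d + 1)) (Fin (2 * d + 1) ⊕ Fin (2 * d + 1)) (Polynomial K) :=
    Matrix.of fun k => Sum.elim
      (fun i => (P ((k : ℕ) - d - (i : ℕ))).comp (X + C ((i : ℕ) : K)))
      (fun i => - (Q ((k : ℕ) - d - (i : ℕ))).comp (X + C ((i : ℕ) : K)))
  have hA : ¬ Function.Injective A.mulVecLin := fun h => by
    have := card_le_of_injective (Polynomial K) _ h
    simp at this
    omega
  rw [← LinearMap.ker_eq_bot, Submodule.eq_bot_iff] at hA
  push Not at hA
  obtain ⟨v, hv, hv0⟩ := hA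
  refine ⟨2 * d + 1, max M₁ M₂, fun i => v (Sum.inl i), fun i => v (Sum.inr i), ?_, ?_⟩
  · by_contra! h
    refine hv0 (funext fun i => ?_)
    cases i with
    | inl i => exact congrFun h.1 i
    | inr i => exact congrFun h.2 i
  · intro m hm
    refine ext_dcoord fun l => ?_
    rw [dcoord_mul_shiftOp hP _ hm, dcoord_mul_shiftOp hQ _ hm]
    congr 1
    by_cases hl : 0 ≤ (l : ℤ) - m + d ∧ (l : ℤ) - m + d < 4 * d + 1
    · obtain ⟨k, hk⟩ := Int.eq_ofNat_of_zero_le hl.1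
      have hk' : (l : ℤ) - m = k - d := by omega
      have h := congrFun (LinearMap.mem_ker.1 hv) ⟨k, by omega⟩
      simp only [Matrix.mulVecLin_apply, Matrix.mulVec, dotProduct, Fintype.sum_sum_type, A,
        Matrix.of_apply, Sum.elim_inl, Sum.elim_inr, neg_mul, Finset.sum_neg_distrib,
        Pi.zero_apply] at h
      rw [hk']
      exact add_neg_eq_zero.1 h
    · rw [Finset.sum_eq_zero, Finset.sum_eq_zero]
      · exact fun i _ => by rw [hQ.1 _ (by have := i.2; omega), Polynomial.zero_comp, zero_mul]
      · exact fun i _ => by rw [hP.1 _ (by have := i.2; omega), Polynomial.zero_comp, zero_mul]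

lemma eq_zero_of_shiftOp_dpow_eq_zero {n M : ℕ} {B : Fin n → Polynomial K}
    (h : ∀ m ≥ M, shiftOp B (dpow K m) = 0) : B = 0 := by
  funext i
  by_contra hi
  obtain ⟨M', hM'⟩ := exists_forall_eval_ne_zero hi
  refine hM' (max M M') (le_max_right _ _) ?_
  have := congrArg (dcoord K (max M M' + i)) (h _ (le_max_left M M'))
  simpa [shiftOp_dpow, dcoord_dpow, Fin.val_inj] using this

/-! ### Regular elements -/

lemma isRegular_of_bijective {a : I1 K}
    (ha : Function.Bijective ⇑(a : Module.End K (Polynomial K))) : IsRegular a := by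
  refine ⟨fun b c h => Subtype.ext (LinearMap.ext fun p => ha.1 ?_),
    fun b c h => Subtype.ext (LinearMap.ext fun p => ?_)⟩
  · exact LinearMap.congr_fun (congrArg Subtype.val h) p
  · obtain ⟨q, rfl⟩ := ha.2 p
    exact LinearMap.congr_fun (congrArg Subtype.val h) q

lemma injective_of_isLeftRegular {a : I1 K} (ha : IsLeftRegular a) :
    Function.Injective ⇑(a : Module.End K (Polynomial K)) := by
  refine (injective_iff_map_eq_zero _).2 fun v hv => ?_
  have h : a * ⟨_, smulRight_mem_I1 0 v⟩ = a * 0 := Subtype.ext (LinearMap.ext fun p => by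
    simp [hv])
  have := LinearMap.congr_fun (congrArg Subtype.val (ha h)) (dpow K 0)
  simpa [dcoord_dpow] using this

/-- If `s` is not surjective, there is `a` such that no equation `a * t = s * b` has `t` regular. -/
lemma surjective_of_forall_exists {s : I1 K}
    (h : ∀ a : I1 K, ∃ b t : I1 K, IsRegular t ∧ a * t = s * b) :
    Function.Surjective ⇑(s : Module.End K (Polynomial K)) := by
  intro v
  by_contra hv
  obtain ⟨b, t, ht, hab⟩ := h ⟨_, smulRight_mem_I1 0 v⟩
  have h0 : (⟨_, smulRight_mem_I1 0 v⟩ : I1 K) * t = 0 * t := Subtype.ext (LinearMap.ext fun p => by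
    have hp := LinearMap.congr_fun (congrArg Subtype.val hab) p
    simp only [Subalgebra.coe_mul, Module.End.mul_apply,
      LinearMap.smulRight_apply] at hp
    by_cases hc : dcoord K 0 ((t : Module.End K (Polynomial K)) p) = 0
    · simp [hc]
    · refine absurd ⟨(dcoord K 0 ((t : Module.End K (Polynomial K)) p))⁻¹ •
        (b : Module.End K (Polynomial K)) p, ?_⟩ hv
      rw [map_smul, ← hp, inv_smul_smul₀ hc])
  have := LinearMap.congr_fun (congrArg Subtype.val (ht.right h0)) (dpow K 0)
  refine hv ⟨0, ?_⟩
  simpa [dcoord_dpow, eq_comm] using this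

lemma exists_rightOre_I10 (a : I1 K) {s : I1 K} (hs : s ∈ I10 K) :
    ∃ b : I1 K, ∃ t ∈ I10 K, a * t = s * b := by
  obtain ⟨n, M, T, B, hTB, hM⟩ := exists_mul_shiftOp_eq a.2 s.2
  have hT : T ≠ 0 := by
    rintro rfl
    refine hTB.elim (fun h => h rfl) fun h => h (eq_zero_of_shiftOp_dpow_eq_zero (M := M) ?_)
    intro m hm
    refine hs.1 ?_
    rw [map_zero, ← Module.End.mul_apply, ← hM m hm]
    simp [shiftOp]
  obtain ⟨e, u, hu, hbij, M', hM'⟩ := exists_bijective_modification hT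
  let σ := LinearEquiv.ofBijective (s : Module.End K (Polynomial K)) hs
  let b : Module.End K (Polynomial K) := σ.symm.toLinearMap * (a * u)
  have hsb : (s : Module.End K (Polynomial K)) * b = a * u :=
    LinearMap.ext fun p => σ.apply_symm_apply _
  have hb : b ∈ I1 K := by
    have h : b - shiftOp B * derOp K ^ e ∈ I1 K :=
      mem_I1_of_apply_dpow_eq_zero (M := max M' (M + e)) fun m hm => hs.1 <| by
        obtain ⟨k, rfl⟩ := Nat.exists_eq_add_of_le'
          ((Nat.le_add_left e M).trans ((le_max_right _ _).trans hm))
        rw [map_zero, LinearMap.sub_apply, map_sub, ← Module.End.mul_apply, hsb,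
          Module.End.mul_apply, hM' _ (by omega), Module.End.mul_apply, Module.End.mul_apply,
          derOp_pow_dpow_add, ← Module.End.mul_apply, ← Module.End.mul_apply, hM k (by omega),
          sub_self]
    simpa using add_mem h (mul_mem (shiftOp_mem B) (pow_mem (derOp_mem K) e))
  exact ⟨⟨b, hb⟩, ⟨u, hu⟩, hbij, Subtype.ext hsb.symm⟩

lemma isRegular_one_sub_intI : IsRegular (1 - intI K) := by
  refine ⟨fun b c h => Subtype.ext (LinearMap.ext fun p => ?_), fun b c h => ?_⟩
  · have hp := LinearMap.congr_fun (congrArg Subtype.val h) p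
    rw [← sub_eq_zero] at hp ⊢
    obtain ⟨q, hq⟩ : ∃ q, (b : Module.End K (Polynomial K)) p - (c : Module.End K _) p = q :=
      ⟨_, rfl⟩
    have hq' : q = intOp K q := by
      rw [← hq]
      simp only [intI, AddSubgroupClass.coe_sub, Subalgebra.coe_mul, Subalgebra.coe_one,
        LinearMap.sub_apply, Module.End.mul_apply, Module.End.one_apply] at hp
      rw [map_sub, ← sub_eq_zero, ← hp]
      abel
    rw [hq]
    refine ext_dcoord fun l => ?_
    rw [map_zero]
    induction l with
    | zero => rw [hq', dcoord_zero_intOp]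
    | succ l ih => rw [hq', dcoord_succ_intOp, ih]
  · rw [← sub_eq_zero]
    have hbc : (b - c) * (1 - intI K) = 0 := by
      exact (sub_mul b c _).trans (sub_eq_zero.2 h)
    have hstep : ∀ m, ((b - c : I1 K) : Module.End K (Polynomial K)) (dpow K (m + 1)) =
        ((b - c : I1 K) : Module.End K (Polynomial K)) (dpow K m) := fun m => by
      have := LinearMap.congr_fun (congrArg Subtype.val hbc) (dpow K m)
      rw [Subalgebra.coe_mul, Module.End.mul_apply] at this
      have h1 : ((1 - intI K : I1 K) : Module.End K (Polynomial K)) (dpow K m) =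
          dpow K m - dpow K (m + 1) := by
        simp [intI, intOp_dpow]
      rw [h1, map_sub] at this
      exact (sub_eq_zero.1 this).symm
    have hconst : ∀ m, ((b - c : I1 K) : Module.End K (Polynomial K)) (dpow K m) =
        ((b - c : I1 K) : Module.End K (Polynomial K)) (dpow K 0) := fun m => by
      induction m with
      | zero => rfl
      | succ m ih => rw [hstep, ih]
    refine Subtype.ext (ext_dpow fun m => ?_)
    rw [hconst, eq_zero_of_apply_dpow_eq (b - c).2 hconst]
    rfl

lemma not_surjective_one_sub_intI :
    ¬ Function.Surjective ⇑((1 - intI K : I1 K) : Module.End K (Polynomial K)) := by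
  intro h
  obtain ⟨p, hp⟩ := h (dpow K 0)
  have hp' : p = dpow K 0 + intOp K p := by
    rw [← hp]
    simp [intI]
  have hone : ∀ l, dcoord K l p = 1 := fun l => by
    induction l with
    | zero => rw [hp', map_add, dcoord_zero_intOp, dcoord_dpow]; simp
    | succ l ih => rw [hp', map_add, dcoord_succ_intOp, dcoord_dpow, ih]; simp
  have := hone (p.natDegree + 1)
  rw [dcoord_eq_zero_of_natDegree_lt (Nat.lt_succ_self _)] at this
  exact zero_ne_one this

lemma bijective_one_sub_derI :
    Function.Bijective ⇑((1 - derI K : I1 K) : Module.End K (Polynomial K)) := by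
  refine bijective_of_degree_eq fun m => ?_
  have h : ((1 - derI K : I1 K) : Module.End K (Polynomial K)) (dpow K m) =
      dpow K m - derOp K (dpow K m) := by simp [derI]
  rw [h]
  cases m with
  | zero => rw [derOp_dpow_zero, sub_zero, degree_dpow]
  | succ m =>
    rw [derOp_dpow_succ, Polynomial.degree_sub_eq_left_of_degree_lt, degree_dpow]
    rw [degree_dpow, degree_dpow]
    exact_mod_cast Nat.lt_succ_self m

lemma not_isLeftRegular_of_mul_eI_eq {b t : I1 K} (h : t * eI K 0 0 = b * (1 - derI K)) :
    ¬ IsLeftRegular t := by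
  intro ht
  have h1 : ∀ m, (t : Module.End K (Polynomial K)) (eOp K 0 0 (dpow K m)) =
      (b : Module.End K (Polynomial K)) (dpow K m - derOp K (dpow K m)) := fun m => by
    have := LinearMap.congr_fun (congrArg Subtype.val h) (dpow K m)
    simpa [eI, derI] using this
  have h0 := h1 0
  rw [eOp_apply, dcoord_dpow, if_pos rfl, one_smul, derOp_dpow_zero, sub_zero] at h0
  have hconst : ∀ m, (b : Module.End K (Polynomial K)) (dpow K m) =
      (t : Module.End K (Polynomial K)) (dpow K 0) := fun m => by
    induction m with
    | zero => exact h0.symm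
    | succ m ih =>
      have hm := h1 (m + 1)
      rw [eOp_apply, dcoord_dpow, if_neg (Nat.succ_ne_zero m).symm, zero_smul, map_zero,
        derOp_dpow_succ, map_sub] at hm
      rw [← ih]
      exact (sub_eq_zero.1 hm.symm)
  have hz := eq_zero_of_apply_dpow_eq b.2 hconst
  have hd := injective_of_isLeftRegular ht (hz.trans (map_zero _).symm)
  simpa [hd] using degree_dpow (K := K) 0

variable (K)

/-- (1) `I₁⁰` is a multiplicatively closed set of regular elements
satisfying the right Ore condition; (2) it contains every multiplicatively closed set of
regular elements satisfying the right Ore condition; (3) the set of all regular elements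
of `I₁` satisfies neither the right nor the left Ore condition. -/
theorem statement19 :
    ((∀ a ∈ I10 K, IsRegular a)
      ∧ ((1 : I1 K) ∈ I10 K ∧ ∀ a ∈ I10 K, ∀ b ∈ I10 K, a * b ∈ I10 K)
      ∧ (∀ (a : I1 K), ∀ s ∈ I10 K, ∃ (b : I1 K), ∃ t ∈ I10 K, a * t = s * b))
    ∧ (∀ S : Set (I1 K), (∀ s ∈ S, ∀ t ∈ S, s * t ∈ S) → (∀ s ∈ S, IsRegular s) →
        (∀ (a : I1 K), ∀ s ∈ S, ∃ (b : I1 K), ∃ t ∈ S, a * t = s * b) → S ⊆ I10 K)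
    ∧ ¬ (∀ (a s : I1 K), IsRegular s →
          ∃ (b t : I1 K), IsRegular t ∧ a * t = s * b)
    ∧ ¬ (∀ (a s : I1 K), IsRegular s →
          ∃ (b t : I1 K), IsRegular t ∧ t * a = b * s) := by
  refine ⟨⟨fun a ha => isRegular_of_bijective ha,
    ⟨Function.bijective_id, fun a ha b hb => ha.comp hb⟩,
    fun a s hs => exists_rightOre_I10 a hs⟩, fun S _ hreg hore s hs => ?_, fun h => ?_, fun h => ?_⟩
  · refine ⟨injective_of_isLeftRegular (hreg s hs).left, surjective_of_forall_exists fun a => ?_⟩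
    obtain ⟨b, t, ht, hab⟩ := hore a s hs
    exact ⟨b, t, hreg t ht, hab⟩
  · exact not_surjective_one_sub_intI
      (surjective_of_forall_exists fun a => h a _ (isRegular_one_sub_intI (K := K)))
  · obtain ⟨b, t, ht, hab⟩ := h (eI K 0 0) _ (isRegular_of_bijective bijective_one_sub_derI)
    exact not_isLeftRegular_of_mul_eI_eq hab ht.left

end
end
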